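/- Let Γ ⊂ ℤ^n be an almost periodic pattern and P ∈ O_n(ℝ). Then the image set P̂(Γ) = {π(P x) : x ∈ Γ} is an almost periodic pattern. -/

import Mathlib

open Filter MeasureTheory
open scoped BigOperators

noncomputable section

/-- The projection `p : ℝ → ℤ`: the unique `k` with `k - 1/2 < x ≤ k + 1/2`. -/
def roundHalf (x : ℝ) : ℤ := ⌈x - 1/2⌉

/-- Coercion of an integer vector to a real vector. -/
def intVec {n : ℕ} (v : Fin n → ℤ) : Fin n → ℝ := fun i => (v i : ℝ)

/-- The set of integer points of `ℝ^n`. -/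
def intPoints (n : ℕ) : Set (Fin n → ℝ) := Set.range (intVec (n := n))

/-- The coordinatewise projection `π : ℝ^n → ℤ^n`. -/
def discretize {n : ℕ} (x : Fin n → ℝ) : Fin n → ℤ := fun i => roundHalf (x i)

/-- `π` viewed as a self-map of `ℝ^n`. -/
def discretizeR {n : ℕ} (x : Fin n → ℝ) : Fin n → ℝ := intVec (discretize x)

/-- The image of a set `Γ` under the discretization `P̂` of the matrix `P`. -/
def PhatImg {n : ℕ} (P : Matrix (Fin n) (Fin n) ℝ) (Γ : Set (Fin n → ℝ)) :
    Set (Fin n → ℝ) :=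
  (fun x => discretizeR (P.mulVec x)) '' Γ

/-- The uniform `R`-density `D_R^+`. Balls are sup-norm balls. -/
def DRplus {n : ℕ} (Γ : Set (Fin n → ℝ)) (R : ℝ) : ℝ :=
  ⨆ x : Fin n → ℝ,
    ((Metric.ball x R ∩ Γ).ncard : ℝ) / ((Metric.ball x R ∩ intPoints n).ncard : ℝ)

/-- Relatively dense with parameter `R₀`. -/
def RelativelyDenseWith {n : ℕ} (Γ : Set (Fin n → ℝ)) (R₀ : ℝ) : Prop :=
  ∀ x : Fin n → ℝ, ∀ r, R₀ ≤ r → (Metric.ball x r ∩ Γ).Nonempty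

def RelativelyDense {n : ℕ} (Γ : Set (Fin n → ℝ)) : Prop :=
  ∃ R₀ > 0, RelativelyDenseWith Γ R₀

/-- Uniformly discrete with parameter `r₀`. -/
def UniformlyDiscreteWith {n : ℕ} (Γ : Set (Fin n → ℝ)) (r₀ : ℝ) : Prop :=
  ∀ x : Fin n → ℝ, ∀ r, 0 < r → r ≤ r₀ → (Metric.ball x r ∩ Γ).Subsingleton

def UniformlyDiscrete {n : ℕ} (Γ : Set (Fin n → ℝ)) : Prop :=
  ∃ r₀ > 0, UniformlyDiscreteWith Γ r₀

def Delone {n : ℕ} (Γ : Set (Fin n → ℝ)) : Prop :=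
  RelativelyDense Γ ∧ UniformlyDiscrete Γ

/-- The translateSet `Γ + v`. -/
def translateSet {n : ℕ} (Γ : Set (Fin n → ℝ)) (v : Fin n → ℝ) : Set (Fin n → ℝ) :=
  (· + v) '' Γ

/-- `N` is a set of `ε`-translations of `Γ` with radius `Rε`. -/
def IsEpsTranslationSet {n : ℕ} (Γ : Set (Fin n → ℝ)) (ε Rε : ℝ)
    (N : Set (Fin n → ℝ)) : Prop :=
  N ⊆ intPoints n ∧ RelativelyDense N ∧
    ∀ R, Rε ≤ R → ∀ v ∈ N, DRplus (symmDiff (translateSet Γ v) Γ) R < ε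

/-- Almost periodic pattern. -/
def AlmostPeriodicPattern {n : ℕ} (Γ : Set (Fin n → ℝ)) : Prop :=
  Γ ⊆ intPoints n ∧ Delone Γ ∧
    ∀ ε > 0, ∃ Rε > 0, ∃ N : Set (Fin n → ℝ), IsEpsTranslationSet Γ ε Rε N

/-- `Γ` has uniform density `D`. -/
def HasUnifDensity {n : ℕ} (Γ : Set (Fin n → ℝ)) (D : ℝ) : Prop :=
  ∀ ε > 0, ∃ R₀ > 0, ∀ R, R₀ ≤ R → ∀ x : Fin n → ℝ,
    |((Metric.ball x R ∩ Γ).ncard : ℝ) / ((Metric.ball x R ∩ intPoints n).ncard : ℝ) - D| ≤ ε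

/-- `Γ ∩ (Γ - v)`, the set of `x ∈ Γ` with `x + v ∈ Γ`. -/
def diffSet {n : ℕ} (Γ : Set (Fin n → ℝ)) (v : Fin n → ℝ) : Set (Fin n → ℝ) :=
  Γ ∩ {x | x + v ∈ Γ}

/-- `E` is equidistributed modulo `ℤ^n`: averages of continuous `ℤ^n`-periodic functions over
`E ∩ B_R` converge to the Haar integral. -/
def EquidistributedModZn {n : ℕ} (E : Set (Fin n → ℝ)) : Prop :=
  ∀ f : (Fin n → ℝ) → ℝ, Continuous f →
    (∀ (x : Fin n → ℝ) (v : Fin n → ℤ), f (x + intVec v) = f x) →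
    Filter.Tendsto (fun R : ℝ =>
        (∑ᶠ x ∈ E ∩ Metric.ball (0 : Fin n → ℝ) R, f x) /
          ((E ∩ Metric.ball (0 : Fin n → ℝ) R).ncard : ℝ))
      Filter.atTop
      (nhds (∫ x in Set.pi Set.univ (fun _ : Fin n => Set.Ico (0:ℝ) 1), f x))

/-- `P` is totally irrational: `P(ℤ^n)` is equidistributed modulo `ℤ^n`. -/
def TotallyIrrational {n : ℕ} (P : Matrix (Fin n) (Fin n) ℝ) : Prop :=
  EquidistributedModZn (P.mulVec '' intPoints n)

/-- Rate of injectivity in time 1. -/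
def tauOne {n : ℕ} (P : Matrix (Fin n) (Fin n) ℝ) : ℝ :=
  Filter.limsup (fun R : ℝ =>
    ((PhatImg P (intPoints n) ∩ Metric.ball (0 : Fin n → ℝ) R).ncard : ℝ) /
      ((intPoints n ∩ Metric.ball (0 : Fin n → ℝ) R).ncard : ℝ)) Filter.atTop

/-- The successive images `(P̂_k ∘ ⋯ ∘ P̂_1)(Γ)`. -/
def seqImg {n : ℕ} (P : ℕ → Matrix (Fin n) (Fin n) ℝ) :
    ℕ → Set (Fin n → ℝ) → Set (Fin n → ℝ)
  | 0, Γ => Γ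
  | k + 1, Γ => PhatImg (P (k + 1)) (seqImg P k Γ)

/-- Rate of injectivity in time `k` of the sequence `(P_k)`. -/
def tauK {n : ℕ} (P : ℕ → Matrix (Fin n) (Fin n) ℝ) (k : ℕ) : ℝ :=
  Filter.limsup (fun R : ℝ =>
    ((seqImg P k (intPoints n) ∩ Metric.ball (0 : Fin n → ℝ) R).ncard : ℝ) /
      ((intPoints n ∩ Metric.ball (0 : Fin n → ℝ) R).ncard : ℝ)) Filter.atTop

/-- A fixed norm on `M_n(ℝ)`: the sup of absolute values of the entries. -/
def matNorm {n : ℕ} (A : Matrix (Fin n) (Fin n) ℝ) : ℝ :=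
  ⨆ p : Fin n × Fin n, |A p.1 p.2|


/-- The function `φ_u`, a "weighted projection" of `u` on `ℤ^n`. -/
def phiFn {n : ℕ} (u : Fin n → ℝ) (v : Fin n → ℤ) : ℝ :=
  if ‖u - intVec v‖ < 1 then ∏ i, (1 - |u i - (v i : ℝ)|) else 0

/-- `I_ℚ(A)`: the set of indices `i` such that all entries of the `i`-th row of `A`
are rational. -/
def IQ {n : ℕ} (A : Matrix (Fin n) (Fin n) ℝ) : Set (Fin n) :=
  {i | ∀ j, ∃ q : ℚ, A i j = (q : ℝ)}

/-- A sequence of matrices all lying in `O_n(ℝ)`. -/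
def IsOnSeq {n : ℕ} (P : ℕ → Matrix (Fin n) (Fin n) ℝ) : Prop :=
  ∀ k, P k ∈ Matrix.orthogonalGroup (Fin n) ℝ

/-- The `ℓ^∞` distance on sequences of matrices. -/
def seqDist {n : ℕ} (P Q : ℕ → Matrix (Fin n) (Fin n) ℝ) : ℝ :=
  ⨆ k : ℕ, matNorm (P k - Q k)

/-- Open subsets of `ℓ^∞(O_n(ℝ))`. -/
def IsOpenSeq {n : ℕ} (U : Set {P : ℕ → Matrix (Fin n) (Fin n) ℝ // IsOnSeq P}) : Prop :=
  ∀ P ∈ U, ∃ δ > 0, ∀ Q : {P : ℕ → Matrix (Fin n) (Fin n) ℝ // IsOnSeq P},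
    seqDist P.1 Q.1 < δ → Q ∈ U

/-- Dense subsets of `ℓ^∞(O_n(ℝ))`. -/
def IsDenseSeq {n : ℕ} (U : Set {P : ℕ → Matrix (Fin n) (Fin n) ℝ // IsOnSeq P}) : Prop :=
  ∀ P : {P : ℕ → Matrix (Fin n) (Fin n) ℝ // IsOnSeq P}, ∀ δ > 0,
    ∃ Q ∈ U, seqDist P.1 Q.1 < δ

lemma intVec_injective {n : ℕ} : Function.Injective (intVec (n := n)) := by
  intro u v h
  funext i
  exact Int.cast_injective (α := ℝ) (congrFun h i)

lemma add_mem_intPoints {n : ℕ} {x y : Fin n → ℝ} (hx : x ∈ intPoints n)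
    (hy : y ∈ intPoints n) : x + y ∈ intPoints n := by
  obtain ⟨u, rfl⟩ := hx
  obtain ⟨v, rfl⟩ := hy
  exact ⟨u + v, by funext i; simp [intVec]⟩

lemma sub_mem_intPoints {n : ℕ} {x y : Fin n → ℝ} (hx : x ∈ intPoints n)
    (hy : y ∈ intPoints n) : x - y ∈ intPoints n := by
  obtain ⟨u, rfl⟩ := hx
  obtain ⟨v, rfl⟩ := hy
  exact ⟨u - v, by funext i; simp [intVec]⟩

lemma mem_translateSet {n : ℕ} {A : Set (Fin n → ℝ)} {v x : Fin n → ℝ} :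
    x ∈ translateSet A v ↔ x - v ∈ A := by
  constructor
  · rintro ⟨y, hy, rfl⟩
    simpa using hy
  · intro h
    exact ⟨x - v, h, by simp⟩

lemma translateSet_subset_intPoints {n : ℕ} {A : Set (Fin n → ℝ)} {v : Fin n → ℝ}
    (hA : A ⊆ intPoints n) (hv : v ∈ intPoints n) : translateSet A v ⊆ intPoints n := by
  rintro _ ⟨y, hy, rfl⟩
  exact add_mem_intPoints (hA hy) hv

lemma symmDiff_translateSet_subset_intPoints {n : ℕ} {A : Set (Fin n → ℝ)} {v : Fin n → ℝ}
    (hA : A ⊆ intPoints n) (hv : v ∈ intPoints n) :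
    symmDiff (translateSet A v) A ⊆ intPoints n :=
  symmDiff_le_sup.trans (Set.union_subset (translateSet_subset_intPoints hA hv) hA)

lemma ball_inter_intPoints {n : ℕ} (c : Fin n → ℝ) {R : ℝ} (hR : 0 < R) :
    Metric.ball c R ∩ intPoints n =
      intVec '' (Fintype.piFinset fun i => Finset.Ioo ⌊c i - R⌋ ⌈c i + R⌉ : Finset (Fin n → ℤ)) := by
  ext x
  simp only [Set.mem_inter_iff, intPoints, Set.mem_range, Set.mem_image, Finset.mem_coe,
    Fintype.mem_piFinset, Finset.mem_Ioo, Int.floor_lt, Int.lt_ceil]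
  have key : ∀ v : Fin n → ℤ, intVec v ∈ Metric.ball c R ↔
      ∀ i, c i - R < (v i : ℝ) ∧ (v i : ℝ) < c i + R := by
    intro v
    rw [Metric.mem_ball, dist_pi_lt_iff hR]
    refine forall_congr' fun i => ?_
    rw [Real.dist_eq, abs_sub_lt_iff, intVec]
    constructor <;> rintro ⟨h1, h2⟩ <;> constructor <;> linarith
  constructor
  · rintro ⟨hx, v, rfl⟩
    exact ⟨v, (key v).1 hx, rfl⟩
  · rintro ⟨v, hv, rfl⟩
    exact ⟨(key v).2 hv, v, rfl⟩

lemma finite_ball_inter {n : ℕ} {A : Set (Fin n → ℝ)} (hA : A ⊆ intPoints n)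
    (c : Fin n → ℝ) (R : ℝ) : (Metric.ball c R ∩ A).Finite := by
  rcases le_or_gt R 0 with h | h
  · simp [Metric.ball_eq_empty.2 h]
  · refine Set.Finite.subset ?_ (Set.inter_subset_inter_right _ hA)
    rw [ball_inter_intPoints c h]
    exact (Finset.finite_toSet _).image _

lemma ncard_ball_inter_intPoints {n : ℕ} (c : Fin n → ℝ) {R : ℝ} (hR : 0 < R) :
    ((Metric.ball c R ∩ intPoints n).ncard : ℝ) =
      ∏ i, (((⌈c i + R⌉ - ⌊c i - R⌋ - 1).toNat : ℕ) : ℝ) := by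
  rw [ball_inter_intPoints c hR, Set.ncard_image_of_injective _ intVec_injective,
    Set.ncard_coe_finset, Fintype.card_piFinset]
  simp

lemma ncard_ball_intPoints_bounds {n : ℕ} (c : Fin n → ℝ) {R : ℝ} (hR : 1 ≤ R) :
    R ^ n ≤ ((Metric.ball c R ∩ intPoints n).ncard : ℝ) ∧
      ((Metric.ball c R ∩ intPoints n).ncard : ℝ) ≤ (3 * R) ^ n := by
  rw [ncard_ball_inter_intPoints c (by linarith)]
  have key : ∀ i, R ≤ (((⌈c i + R⌉ - ⌊c i - R⌋ - 1).toNat : ℕ) : ℝ) ∧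
      (((⌈c i + R⌉ - ⌊c i - R⌋ - 1).toNat : ℕ) : ℝ) ≤ 3 * R := by
    intro i
    have h1 := Int.le_ceil (c i + R)
    have h2 := Int.ceil_lt_add_one (c i + R)
    have h3 := Int.floor_le (c i - R)
    have h4 := Int.lt_floor_add_one (c i - R)
    have h5 : (0 : ℤ) ≤ ⌈c i + R⌉ - ⌊c i - R⌋ - 1 := by
      have : (0 : ℝ) ≤ ((⌈c i + R⌉ - ⌊c i - R⌋ - 1 : ℤ) : ℝ) := by push_cast; linarith
      exact_mod_cast this
    have h6 : (((⌈c i + R⌉ - ⌊c i - R⌋ - 1).toNat : ℕ) : ℝ) =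
        ((⌈c i + R⌉ - ⌊c i - R⌋ - 1 : ℤ) : ℝ) := by
      exact_mod_cast Int.toNat_of_nonneg h5
    rw [h6]
    push_cast
    constructor <;> linarith
  constructor
  · calc R ^ n = ∏ _i : Fin n, R := by simp
      _ ≤ _ := Finset.prod_le_prod (fun _ _ => by linarith) fun i _ => (key i).1
  · calc _ ≤ ∏ _i : Fin n, (3 * R) :=
        Finset.prod_le_prod (fun _ _ => by positivity) fun i _ => (key i).2
      _ = _ := by simp

lemma ncard_ball_le_of_DRplus_le {n : ℕ} {A : Set (Fin n → ℝ)} (hA : A ⊆ intPoints n)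
    {ε R : ℝ} (hR : 1 ≤ R) (h : DRplus A R ≤ ε) (c : Fin n → ℝ) :
    ((Metric.ball c R ∩ A).ncard : ℝ) ≤ ε * 3 ^ n * R ^ n := by
  have hbdd : BddAbove (Set.range fun x : Fin n → ℝ =>
      ((Metric.ball x R ∩ A).ncard : ℝ) / ((Metric.ball x R ∩ intPoints n).ncard : ℝ)) := by
    refine ⟨1, ?_⟩
    rintro _ ⟨x, rfl⟩
    refine div_le_one_of_le₀ ?_ (Nat.cast_nonneg _)
    exact_mod_cast Set.ncard_le_ncard (Set.inter_subset_inter_right _ hA)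
      (finite_ball_inter subset_rfl x R)
  have h1 := (le_ciSup hbdd c).trans h
  obtain ⟨h2, h3⟩ := ncard_ball_intPoints_bounds c hR
  have hpos : 0 < ((Metric.ball c R ∩ intPoints n).ncard : ℝ) :=
    lt_of_lt_of_le (by positivity) h2
  have hε : 0 ≤ ε := le_trans (by positivity) h1
  rw [div_le_iff₀ hpos] at h1
  calc _ ≤ _ := h1
    _ ≤ ε * (3 * R) ^ n := by gcongr
    _ = _ := by rw [mul_pow]; ring

lemma DRplus_le_of_ncard_ball_le {n : ℕ} {A : Set (Fin n → ℝ)} {ε R : ℝ} (hR : 1 ≤ R)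
    (hε : 0 ≤ ε) (h : ∀ c, ((Metric.ball c R ∩ A).ncard : ℝ) ≤ ε * R ^ n) :
    DRplus A R ≤ ε := by
  refine ciSup_le fun c => ?_
  obtain ⟨h2, -⟩ := ncard_ball_intPoints_bounds c hR
  have hpos : 0 < ((Metric.ball c R ∩ intPoints n).ncard : ℝ) :=
    lt_of_lt_of_le (by positivity) h2
  rw [div_le_iff₀ hpos]
  exact (h c).trans (by gcongr)

lemma ncard_ball_translateSet {n : ℕ} (A : Set (Fin n → ℝ)) (v c : Fin n → ℝ) (R : ℝ) :
    (Metric.ball c R ∩ translateSet A v).ncard = (Metric.ball (c - v) R ∩ A).ncard := by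
  rw [← Set.ncard_image_of_injective (Metric.ball (c - v) R ∩ A) (add_left_injective v)]
  congr 1
  ext x
  constructor
  · rintro ⟨h1, y, hy, rfl⟩
    refine ⟨y, ⟨?_, hy⟩, rfl⟩
    simpa [Metric.mem_ball, dist_eq_norm, sub_sub_eq_add_sub] using h1
  · rintro ⟨y, ⟨h1, hy⟩, rfl⟩
    refine ⟨?_, y, hy, rfl⟩
    simpa [Metric.mem_ball, dist_eq_norm, sub_sub_eq_add_sub] using h1

lemma ncard_ball_symmDiff_sub_le {n : ℕ} {Γ : Set (Fin n → ℝ)} (hΓ : Γ ⊆ intPoints n)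
    {u v : Fin n → ℝ} (hu : u ∈ intPoints n) (hv : v ∈ intPoints n) (c : Fin n → ℝ) (R : ℝ) :
    (Metric.ball c R ∩ symmDiff (translateSet Γ (v - u)) Γ).ncard ≤
      (Metric.ball (c + u) R ∩ symmDiff (translateSet Γ v) Γ).ncard +
      (Metric.ball (c + u) R ∩ symmDiff (translateSet Γ u) Γ).ncard := by
  have hfv := finite_ball_inter (symmDiff_translateSet_subset_intPoints hΓ hv) (c + u) R
  have hfu := finite_ball_inter (symmDiff_translateSet_subset_intPoints hΓ hu) (c + u) R
  refine le_trans ?_ (Set.ncard_union_le _ _)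
  refine Set.ncard_le_ncard_of_injOn (· + u) ?_ (add_left_injective u).injOn (hfv.union hfu)
  rintro x ⟨hx, hxs⟩
  have hb : x + u ∈ Metric.ball (c + u) R := by simpa [Metric.mem_ball] using hx
  simp only [Set.mem_symmDiff, mem_translateSet, Set.mem_union, Set.mem_inter_iff, hb,
    true_and] at hxs ⊢
  have e1 : x + u - v = x - (v - u) := by abel
  have e2 : x + u - u = x := by abel
  rw [e1, e2]
  tauto

lemma relativelyDense_sub_of_finite {n : ℕ} {N : Set (Fin n → ℝ)} (hN : RelativelyDense N)
    {α : Type*} [Finite α] (κ : (Fin n → ℝ) → α) :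
    RelativelyDense {x | ∃ v ∈ N, ∃ u ∈ N, κ v = κ u ∧ x = v - u} := by
  obtain ⟨R₀, hR₀, hd⟩ := hN
  have hrep : ∀ k : α, ∃ u : Fin n → ℝ, ∀ v ∈ N, κ v = k → u ∈ N ∧ κ u = k := by
    intro k
    by_cases h : ∃ v ∈ N, κ v = k
    · obtain ⟨u, hu, hk⟩ := h
      exact ⟨u, fun _ _ _ => ⟨hu, hk⟩⟩
    · exact ⟨0, fun v hv hk => absurd ⟨v, hv, hk⟩ h⟩
  choose u hu using hrep
  obtain ⟨M, hM⟩ := Set.Finite.bddAbove (Set.finite_range fun k => ‖u k‖)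
  refine ⟨R₀ + max M 0, by positivity, fun x r hr => ?_⟩
  obtain ⟨v, hvx, hvN⟩ := hd x R₀ le_rfl
  obtain ⟨h1, h2⟩ := hu (κ v) v hvN rfl
  refine ⟨v - u (κ v), ?_, v, hvN, _, h1, h2.symm, rfl⟩
  have h3 : ‖u (κ v)‖ ≤ M := hM ⟨κ v, rfl⟩
  rw [Metric.mem_ball, dist_eq_norm] at hvx ⊢
  calc ‖v - u (κ v) - x‖ = ‖(v - x) - u (κ v)‖ := by congr 1; abel
    _ ≤ ‖v - x‖ + ‖u (κ v)‖ := norm_sub_le _ _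
    _ < r := by linarith [le_max_left M 0]

lemma abs_roundHalf_sub_le (x : ℝ) : |(roundHalf x : ℝ) - x| ≤ 1 / 2 := by
  have h1 := Int.le_ceil (x - 1 / 2)
  have h2 := Int.ceil_lt_add_one (x - 1 / 2)
  rw [roundHalf, abs_le]
  constructor <;> linarith

lemma roundHalf_add_intCast (x : ℝ) (w : ℤ) : roundHalf (x + w) = roundHalf x + w := by
  rw [roundHalf, roundHalf, ← Int.ceil_add_intCast]
  congr 1
  ring

lemma roundHalf_add_of_far {x t δ : ℝ} (ht : |t| < δ)
    (hx : ∀ m : ℤ, δ ≤ |x - m - 1 / 2|) : roundHalf (x + t) = roundHalf x := by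
  have h1 := Int.le_ceil (x - 1 / 2)
  have h2 := Int.ceil_lt_add_one (x - 1 / 2)
  have h3 := hx ⌈x - 1 / 2⌉
  have h4 := hx (⌈x - 1 / 2⌉ - 1)
  rw [abs_of_nonpos (by linarith)] at h3
  rw [abs_of_nonneg (by push_cast; linarith)] at h4
  push_cast at h4
  obtain ⟨h5, h6⟩ := abs_lt.1 ht
  rw [roundHalf, roundHalf, Int.ceil_eq_iff]
  constructor <;> linarith

lemma norm_discretizeR_sub_le {n : ℕ} (x : Fin n → ℝ) : ‖discretizeR x - x‖ ≤ 1 / 2 := by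
  refine (pi_norm_le_iff_of_nonneg (by norm_num)).2 fun i => ?_
  exact abs_roundHalf_sub_le (x i)

lemma exists_pos_le_abs_natCast_mul_sub {α : ℝ} (hα : Irrational α) (K : ℕ) :
    ∃ δ > 0, ∀ k : ℕ, 1 ≤ k → k ≤ K → ∀ m : ℤ, δ ≤ |(k : ℝ) * α - m| := by
  induction K with
  | zero => exact ⟨1, one_pos, fun k h1 h2 => by omega⟩
  | succ K ih =>
    obtain ⟨δ, hδ, h⟩ := ih
    have hirr : Irrational (((K + 1 : ℕ) : ℝ) * α) := hα.natCast_mul (by omega)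
    have hpos : 0 < |((K + 1 : ℕ) : ℝ) * α - round (((K + 1 : ℕ) : ℝ) * α)| :=
      abs_pos.2 (sub_ne_zero.2 (hirr.ne_int _))
    refine ⟨min δ _, lt_min hδ hpos, fun k h1 h2 m => ?_⟩
    rcases Nat.lt_or_ge K k with h3 | h3
    · obtain rfl : k = K + 1 := by omega
      exact (min_le_right _ _).trans (round_le _ m)
    · exact (min_le_left _ _).trans (h k h1 h3 m)

/-- Eventually in `R`, every ball of radius `R` contains at most `η * R ^ n` points of `A`. -/
def Sparse {n : ℕ} (A : Set (Fin n → ℝ)) (η : ℝ) : Prop :=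
  ∀ᶠ R : ℝ in atTop, ∀ c : Fin n → ℝ, ((Metric.ball c R ∩ A).ncard : ℝ) ≤ η * R ^ n

lemma single_natCast_mem_intPoints {n : ℕ} (j : Fin n) (k : ℕ) :
    Pi.single j (k : ℝ) ∈ intPoints n := by
  refine ⟨Pi.single j (k : ℤ), ?_⟩
  funext i
  by_cases h : i = j
  · subst h
    simp [intVec]
  · simp [intVec, h]

lemma add_single_mem_ball {n : ℕ} {c x : Fin n → ℝ} {R : ℝ} (hx : x ∈ Metric.ball c R)
    {j : Fin n} {k K : ℕ} (hk : k ≤ K) : x + Pi.single j (k : ℝ) ∈ Metric.ball c (R + K) := by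
  have h : ‖(Pi.single j (k : ℝ) : Fin n → ℝ)‖ ≤ K := by
    rw [Pi.norm_single, Real.norm_natCast]
    exact_mod_cast hk
  rw [Metric.mem_ball, dist_eq_norm] at hx ⊢
  rw [add_sub_right_comm]
  linarith [norm_add_le (x - c) (Pi.single j (k : ℝ))]

lemma sparse_of_disjoint_translates {n : ℕ} {B : Set (Fin n → ℝ)} (hB : B ⊆ intPoints n)
    (j : Fin n) (K : ℕ) {η : ℝ} (hη : 6 ^ n ≤ η * (K + 1))
    (hdisj : ∀ x ∈ B, ∀ k : ℕ, 1 ≤ k → k ≤ K → x + Pi.single j (k : ℝ) ∉ B) :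
    Sparse B η := by
  filter_upwards [eventually_ge_atTop (1 : ℝ), eventually_ge_atTop (K : ℝ)] with R hR hRK c
  have hmaps : ∀ q ∈ (Set.univ : Set (Fin (K + 1))) ×ˢ (Metric.ball c R ∩ B),
      q.2 + Pi.single j ((q.1 : ℕ) : ℝ) ∈ Metric.ball c (R + K) ∩ intPoints n := by
    rintro ⟨k, x⟩ ⟨-, hx, hxB⟩
    exact ⟨add_single_mem_ball hx (Nat.lt_succ_iff.1 k.2),
      add_mem_intPoints (hB hxB) (single_natCast_mem_intPoints j k)⟩
  have hlt : ∀ k l : ℕ, k < l → l ≤ K → ∀ x ∈ B, ∀ y ∈ B,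
      x + Pi.single j (k : ℝ) ≠ y + Pi.single j (l : ℝ) := by
    intro k l hkl hl x hx y hy h
    refine hdisj y hy (l - k) (by omega) (by omega) ?_
    have : y + Pi.single j ((l - k : ℕ) : ℝ) = x := by
      rw [Nat.cast_sub hkl.le, Pi.single_sub, ← add_sub_assoc, ← h, add_sub_cancel_right]
    rwa [this]
  have hinj : Set.InjOn (fun q : Fin (K + 1) × (Fin n → ℝ) => q.2 + Pi.single j ((q.1 : ℕ) : ℝ))
      ((Set.univ : Set (Fin (K + 1))) ×ˢ (Metric.ball c R ∩ B)) := by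
    rintro ⟨k, x⟩ ⟨-, -, hx⟩ ⟨l, y⟩ ⟨-, -, hy⟩ h
    simp only at h
    rcases lt_trichotomy (k : ℕ) l with hkl | hkl | hkl
    · exact absurd h (hlt k l hkl (by omega) x hx y hy)
    · obtain rfl : k = l := Fin.ext hkl
      rw [add_right_cancel h]
    · exact absurd h.symm (hlt l k hkl (by omega) y hy x hx)
  have h1 := Set.ncard_le_ncard_of_injOn _ hmaps hinj (finite_ball_inter subset_rfl c (R + K))
  rw [Set.ncard_prod, Set.ncard_univ, Nat.card_fin] at h1
  have h2 := (ncard_ball_intPoints_bounds c (R := R + K) (by linarith)).2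
  have h3 : ((K : ℝ) + 1) * ((Metric.ball c R ∩ B).ncard : ℝ) ≤
      ((Metric.ball c (R + K) ∩ intPoints n).ncard : ℝ) := by exact_mod_cast h1
  have h4 : (3 * (R + K)) ^ n ≤ (6 * R) ^ n :=
    pow_le_pow_left₀ (by positivity) (by linarith) n
  have h5 : (6 * R) ^ n ≤ (K + 1) * (η * R ^ n) := by
    rw [mul_pow, ← mul_assoc, mul_comm ((K : ℝ) + 1) η]
    gcongr
  have hK : (0 : ℝ) < (K : ℝ) + 1 := by positivity
  exact le_of_mul_le_mul_left (h3.trans (h2.trans (h4.trans h5))) hK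

lemma exists_natCast_mul_eq_intCast {n : ℕ} {a : Fin n → ℝ} (ha : ∀ j, ¬ Irrational (a j)) :
    ∃ q : ℕ, 0 < q ∧ ∀ x ∈ intPoints n, ∃ m : ℤ, (q : ℝ) * (a ⬝ᵥ x) = m := by
  have ha' : ∀ j, ∃ r : ℚ, (r : ℝ) = a j := fun j => by simpa [Irrational] using ha j
  choose r hr using ha'
  have hq : ∀ j, ∃ m : ℤ, ((∏ j, (r j).den : ℕ) : ℝ) * a j = m := by
    intro j
    obtain ⟨d, hd⟩ := Finset.dvd_prod_of_mem (fun j => (r j).den) (Finset.mem_univ j)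
    refine ⟨(r j).num * d, ?_⟩
    rw [hd, ← hr j]
    have h := Rat.mul_den_eq_num (r j)
    have h' : ((r j : ℚ) : ℝ) * ((r j).den : ℝ) = ((r j).num : ℝ) := by exact_mod_cast h
    push_cast
    rw [← h']
    ring
  choose m hm using hq
  refine ⟨∏ j, (r j).den, Finset.prod_pos fun j _ => (r j).pos, ?_⟩
  rintro _ ⟨v, rfl⟩
  refine ⟨∑ j, m j * v j, ?_⟩
  rw [dotProduct, Finset.mul_sum]
  push_cast
  refine Finset.sum_congr rfl fun j _ => ?_
  rw [← hm j, intVec]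
  push_cast
  ring

lemma exists_sparse_roundHalf_add {n : ℕ} (a : Fin n → ℝ) {η : ℝ} (hη : 0 < η) :
    ∃ δ > 0, ∃ B ⊆ intPoints n, Sparse B η ∧
      ∀ v ∈ intPoints n, ∀ w : ℤ, |a ⬝ᵥ v - w| < δ → ∀ x ∈ intPoints n, x ∉ B →
        roundHalf (a ⬝ᵥ x + a ⬝ᵥ v) = roundHalf (a ⬝ᵥ x) + w := by
  by_cases ha : ∃ j, Irrational (a j)
  · obtain ⟨j, hj⟩ := ha
    obtain ⟨K, hK⟩ := exists_nat_ge ((6 : ℝ) ^ n / η)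
    rw [div_le_iff₀ hη] at hK
    obtain ⟨δ, hδ, hsep⟩ := exists_pos_le_abs_natCast_mul_sub hj K
    refine ⟨δ / 2, by positivity, {x ∈ intPoints n | ∃ m : ℤ, |a ⬝ᵥ x - m - 1 / 2| < δ / 2},
      fun x hx => hx.1, ?_, ?_⟩
    · refine sparse_of_disjoint_translates (fun x hx => hx.1) j K (by nlinarith) ?_
      rintro x ⟨-, m, hm⟩ k hk1 hkK ⟨-, m', hm'⟩
      have h := hsep k hk1 hkK (m' - m)
      rw [dotProduct_add, dotProduct_single] at hm'
      rw [abs_lt] at hm hm'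
      have : |(k : ℝ) * a j - ((m' - m : ℤ) : ℝ)| < δ := by
        rw [abs_lt]
        push_cast
        constructor <;> linarith
      linarith
    · intro v _ w hw x hx hxB
      have e : a ⬝ᵥ x + a ⬝ᵥ v = (a ⬝ᵥ x + (a ⬝ᵥ v - w)) + w := by ring
      rw [e, roundHalf_add_intCast, roundHalf_add_of_far hw]
      intro m
      by_contra! h
      exact hxB ⟨hx, m, h⟩
  · push Not at ha
    obtain ⟨q, hq, hint⟩ := exists_natCast_mul_eq_intCast ha
    have hq' : (0 : ℝ) < q := by exact_mod_cast hq
    refine ⟨1 / q, by positivity, ∅, Set.empty_subset _, ?_, ?_⟩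
    · filter_upwards [eventually_ge_atTop (0 : ℝ)] with R hR c
      simp only [Set.inter_empty, Set.ncard_empty, Nat.cast_zero]
      positivity
    · intro v hv w hw x _ _
      obtain ⟨m, hm⟩ := hint v hv
      have h1 : |((m - q * w : ℤ) : ℝ)| < 1 := by
        push_cast
        rw [← hm, ← mul_sub, abs_mul, abs_of_pos hq']
        rwa [lt_div_iff₀ hq', mul_comm] at hw
      have h2 : m - q * w = 0 := by
        rw [← Int.abs_lt_one_iff]
        exact_mod_cast h1
      have h3 : (m : ℝ) = q * w := by
        have : m = q * w := by omega
        exact_mod_cast this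
      have h4 : a ⬝ᵥ v = w := by
        rw [h3] at hm
        exact mul_left_cancel₀ hq'.ne' hm
      rw [h4, roundHalf_add_intCast]

lemma Sparse.iUnion {n : ℕ} {ι : Type*} [Fintype ι] {B : ι → Set (Fin n → ℝ)} {η : ℝ}
    (h : ∀ i, Sparse (B i) η) : Sparse (⋃ i, B i) (Fintype.card ι * η) := by
  filter_upwards [eventually_all.2 h] with R hR c
  rw [Set.inter_iUnion]
  calc ((⋃ i, Metric.ball c R ∩ B i).ncard : ℝ)
      ≤ ((∑ i, (Metric.ball c R ∩ B i).ncard : ℕ) : ℝ) := by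
        exact_mod_cast Set.ncard_iUnion_le_of_fintype _
    _ = ∑ i, ((Metric.ball c R ∩ B i).ncard : ℝ) := by push_cast; rfl
    _ ≤ ∑ _i : ι, η * R ^ n := Finset.sum_le_sum fun i _ => hR i c
    _ = _ := by simp [mul_assoc]

lemma exists_sparse_discretizeR_add {n : ℕ} (P : Matrix (Fin n) (Fin n) ℝ) {η : ℝ}
    (hη : 0 < η) :
    ∃ δ > 0, ∃ B ⊆ intPoints n, Sparse B η ∧
      ∀ v ∈ intPoints n, ∀ w : Fin n → ℤ, ‖P.mulVec v - intVec w‖ < δ →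
        ∀ x ∈ intPoints n, x ∉ B →
          discretizeR (P.mulVec (x + v)) = discretizeR (P.mulVec x) + intVec w := by
  have hn : (0 : ℝ) < n + 1 := by positivity
  choose d hd B hB hS hround using fun i =>
    exists_sparse_roundHalf_add (P i) (η := η / (n + 1)) (by positivity)
  obtain ⟨δ, hδ, hδd⟩ : ∃ δ > 0, ∀ i, δ ≤ d i := by
    rcases isEmpty_or_nonempty (Fin n) with h | h
    · exact ⟨1, one_pos, fun i => h.elim i⟩
    · obtain ⟨i₀, hi₀⟩ := Finite.exists_min d
      exact ⟨d i₀, hd i₀, hi₀⟩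
  refine ⟨δ, hδ, ⋃ i, B i, Set.iUnion_subset hB, ?_, ?_⟩
  · filter_upwards [Sparse.iUnion hS, eventually_ge_atTop (0 : ℝ)] with R hR hR0 c
    refine (hR c).trans ?_
    gcongr
    rw [Fintype.card_fin, ← mul_div_assoc, div_le_iff₀ hn]
    nlinarith
  · intro v hv w hw x hx hxB
    simp only [Set.mem_iUnion, not_exists] at hxB
    funext i
    have h1 : |P i ⬝ᵥ v - w i| < d i :=
      ((norm_le_pi_norm (P.mulVec v - intVec w) i).trans_lt hw).trans_le (hδd i)
    have h2 := hround i v hv (w i) h1 x hx (hxB i)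
    rw [Matrix.mulVec_add]
    change ((roundHalf (P i ⬝ᵥ x + P i ⬝ᵥ v) : ℤ) : ℝ) = (roundHalf (P i ⬝ᵥ x) : ℝ) + w i
    rw [h2]
    push_cast
    rfl

lemma exists_norm_mulVec_le {n : ℕ} (P : Matrix (Fin n) (Fin n) ℝ) :
    ∃ C > 0, ∀ x, ‖P.mulVec x‖ ≤ C * ‖x‖ := by
  obtain ⟨C, hC, h⟩ := (LinearMap.toContinuousLinearMap P.mulVecLin).bound
  exact ⟨C, hC, fun x => by simpa using h x⟩

lemma PhatImg_subset_intPoints {n : ℕ} (P : Matrix (Fin n) (Fin n) ℝ) (Γ : Set (Fin n → ℝ)) :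
    PhatImg P Γ ⊆ intPoints n := by
  rintro _ ⟨x, -, rfl⟩
  exact ⟨_, rfl⟩

lemma uniformlyDiscrete_of_subset_intPoints {n : ℕ} {A : Set (Fin n → ℝ)}
    (hA : A ⊆ intPoints n) : UniformlyDiscrete A := by
  refine ⟨1 / 2, by norm_num, fun x r _ hr => ?_⟩
  rintro y ⟨hy, hyA⟩ z ⟨hz, hzA⟩
  obtain ⟨u, rfl⟩ := hA hyA
  obtain ⟨v, rfl⟩ := hA hzA
  congr 1
  funext i
  have h1 : dist (intVec u) (intVec v) < 1 := by
    have := dist_triangle_right (intVec u) (intVec v) x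
    rw [Metric.mem_ball] at hy hz
    linarith
  have h2 := (dist_le_pi_dist (intVec u) (intVec v) i).trans_lt h1
  simp only [intVec, Real.dist_eq] at h2
  have h3 : |u i - v i| < 1 := by exact_mod_cast h2
  rw [Int.abs_lt_one_iff] at h3
  omega

/-- Relative density passes to a set lying at bounded distance from the image under an
invertible matrix. -/
lemma RelativelyDense.of_mulVec {n : ℕ} {P Q : Matrix (Fin n) (Fin n) ℝ} (hPQ : P * Q = 1)
    {A A' : Set (Fin n → ℝ)} (hA : RelativelyDense A)
    (h : ∀ x ∈ A, ∃ y ∈ A', ‖y - P.mulVec x‖ ≤ 1) : RelativelyDense A' := by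
  obtain ⟨R₀, hR₀, hd⟩ := hA
  obtain ⟨C, hC, hP⟩ := exists_norm_mulVec_le P
  refine ⟨C * R₀ + 1, by positivity, fun c r hr => ?_⟩
  obtain ⟨x, hx, hxA⟩ := hd (Q.mulVec c) R₀ le_rfl
  obtain ⟨y, hyA, hy⟩ := h x hxA
  refine ⟨y, ?_, hyA⟩
  rw [Metric.mem_ball, dist_eq_norm] at hx ⊢
  have e : P.mulVec (x - Q.mulVec c) = P.mulVec x - c := by
    rw [Matrix.mulVec_sub, Matrix.mulVec_mulVec, hPQ, Matrix.one_mulVec]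
  have h1 := hP (x - Q.mulVec c)
  rw [e] at h1
  have h2 : C * ‖x - Q.mulVec c‖ < C * R₀ := by gcongr
  calc ‖y - c‖ = ‖(y - P.mulVec x) + (P.mulVec x - c)‖ := by congr 1; abel
    _ ≤ ‖y - P.mulVec x‖ + ‖P.mulVec x - c‖ := norm_add_le _ _
    _ < r := by linarith

lemma relativelyDense_near_intPoints {n : ℕ} {Γ : Set (Fin n → ℝ)}
    (hΓ : AlmostPeriodicPattern Γ) (P : Matrix (Fin n) (Fin n) ℝ) {δ η : ℝ} (hδ : 0 < δ)
    (hη : 0 < η) :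
    ∃ N ⊆ intPoints n, RelativelyDense N ∧
      (∀ v ∈ N, ∃ w : Fin n → ℤ, ‖P.mulVec v - intVec w‖ < δ) ∧
      ∀ᶠ R : ℝ in atTop, ∀ v ∈ N, ∀ c,
        ((Metric.ball c R ∩ symmDiff (translateSet Γ v) Γ).ncard : ℝ) ≤ η * R ^ n := by
  obtain ⟨hΓi, -, hap⟩ := hΓ
  obtain ⟨R₁, -, N, hNi, hNd, hN⟩ := hap (η / (2 * 3 ^ n)) (by positivity)
  obtain ⟨K, hK⟩ := exists_nat_gt (1 / δ)
  have hK0 : (0 : ℝ) < K := lt_trans (by positivity) hK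
  rw [div_lt_iff₀ hδ] at hK
  let κ : (Fin n → ℝ) → Fin n → Fin K := fun v i =>
    ⟨⌊K * Int.fract (P.mulVec v i)⌋₊, by
      rw [Nat.floor_lt (mul_nonneg hK0.le (Int.fract_nonneg _))]
      nlinarith [Int.fract_lt_one (P.mulVec v i)]⟩
  refine ⟨_, ?_, relativelyDense_sub_of_finite hNd κ, ?_, ?_⟩
  · rintro _ ⟨v, hv, u, hu, -, rfl⟩
    exact sub_mem_intPoints (hNi hv) (hNi hu)
  · rintro _ ⟨v, hv, u, hu, hvu, rfl⟩
    refine ⟨fun i => ⌊P.mulVec v i⌋ - ⌊P.mulVec u i⌋, (pi_norm_lt_iff hδ).2 fun i => ?_⟩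
    have h1 : ⌊K * Int.fract (P.mulVec v i)⌋₊ = ⌊K * Int.fract (P.mulVec u i)⌋₊ :=
      congrArg Fin.val (congrFun hvu i)
    have h2 : (P.mulVec (v - u) - intVec fun i => ⌊P.mulVec v i⌋ - ⌊P.mulVec u i⌋) i =
        Int.fract (P.mulVec v i) - Int.fract (P.mulVec u i) := by
      rw [Matrix.mulVec_sub]
      simp only [Pi.sub_apply, intVec, Int.fract]
      push_cast
      ring
    rw [h2, Real.norm_eq_abs, abs_lt]
    have h3 := Nat.floor_le (mul_nonneg hK0.le (Int.fract_nonneg (P.mulVec v i)))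
    have h4 := Nat.lt_floor_add_one (K * Int.fract (P.mulVec v i))
    have h5 := Nat.floor_le (mul_nonneg hK0.le (Int.fract_nonneg (P.mulVec u i)))
    have h6 := Nat.lt_floor_add_one (K * Int.fract (P.mulVec u i))
    rw [h1] at h3 h4
    constructor <;> nlinarith
  · filter_upwards [eventually_ge_atTop (1 : ℝ), eventually_ge_atTop R₁] with R hR hR₁
    rintro _ ⟨v, hv, u, hu, -, rfl⟩ c
    have key : ∀ v ∈ N, ((Metric.ball (c + u) R ∩ symmDiff (translateSet Γ v) Γ).ncard : ℝ) ≤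
        η / 2 * R ^ n := by
      intro v hv
      refine (ncard_ball_le_of_DRplus_le (symmDiff_translateSet_subset_intPoints hΓi (hNi hv)) hR
        (hN R hR₁ v hv).le (c + u)).trans_eq ?_
      field_simp
    have h : ((Metric.ball c R ∩ symmDiff (translateSet Γ (v - u)) Γ).ncard : ℝ) ≤
      (Metric.ball (c + u) R ∩ symmDiff (translateSet Γ v) Γ).ncard +
      (Metric.ball (c + u) R ∩ symmDiff (translateSet Γ u) Γ).ncard := by
      exact_mod_cast ncard_ball_symmDiff_sub_le hΓi (hNi hu) (hNi hv) c R
    linarith [key v hv, key u hu]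

lemma symmDiff_PhatImg_subset {n : ℕ} {P : Matrix (Fin n) (Fin n) ℝ} {Γ B : Set (Fin n → ℝ)}
    (hΓ : Γ ⊆ intPoints n) {v w : Fin n → ℝ}
    (hgood : ∀ x ∈ intPoints n, x ∉ B →
      discretizeR (P.mulVec (x + v)) = discretizeR (P.mulVec x) + w) :
    symmDiff (translateSet (PhatImg P Γ) w) (PhatImg P Γ) ⊆
      (fun z => discretizeR (P.mulVec (z - v)) + w) ''
          (symmDiff (translateSet Γ v) Γ ∪ translateSet B v) ∪
        (fun z => discretizeR (P.mulVec z)) ''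
          (symmDiff (translateSet Γ v) Γ ∪ translateSet B v) := by
  rintro y (⟨⟨_, ⟨x, hx, rfl⟩, rfl⟩, hy⟩ | ⟨⟨x, hx, rfl⟩, hy⟩)
  · left
    refine ⟨x + v, ?_, by simp⟩
    by_contra hz
    simp only [Set.mem_union, Set.mem_symmDiff, mem_translateSet, add_sub_cancel_right, hx,
      true_and, not_true, and_false, or_false, not_or, not_not] at hz
    exact hy ⟨x + v, hz.1, hgood x (hΓ hx) hz.2⟩
  · right
    refine ⟨x, ?_, rfl⟩
    by_contra hz
    simp only [Set.mem_union, Set.mem_symmDiff, mem_translateSet, hx,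
      true_and, not_true, and_false, false_or, not_or, not_not] at hz
    refine hy (mem_translateSet.2 ⟨x - v, hz.1, ?_⟩)
    have := hgood (x - v) (hΓ hz.1) hz.2
    rw [sub_add_cancel] at this
    exact eq_sub_of_add_eq this.symm

lemma ball_inter_image_subset {n : ℕ} {P Q : Matrix (Fin n) (Fin n) ℝ} (hQP : Q * P = 1)
    {C : ℝ} (hC : 0 < C) (hQ : ∀ x, ‖Q.mulVec x‖ ≤ C * ‖x‖) (S : Set (Fin n → ℝ))
    {f : (Fin n → ℝ) → Fin n → ℝ} (hf : ∀ z, ‖f z - P.mulVec z‖ ≤ 2)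
    (c : Fin n → ℝ) {R : ℝ} (hR : 2 ≤ R) :
    Metric.ball c R ∩ f '' S ⊆ f '' (Metric.ball (Q.mulVec c) (C * 2 * R) ∩ S) := by
  rintro _ ⟨hy, z, hz, rfl⟩
  refine ⟨z, ⟨?_, hz⟩, rfl⟩
  rw [Metric.mem_ball, dist_eq_norm] at hy ⊢
  have h1 : ‖P.mulVec z - c‖ < 2 * R := by
    calc ‖P.mulVec z - c‖ = ‖(f z - c) - (f z - P.mulVec z)‖ := by congr 1; abel
      _ ≤ ‖f z - c‖ + ‖f z - P.mulVec z‖ := norm_sub_le _ _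
      _ < 2 * R := by linarith [hf z]
  have e : Q.mulVec (P.mulVec z - c) = z - Q.mulVec c := by
    rw [Matrix.mulVec_sub, Matrix.mulVec_mulVec, hQP, Matrix.one_mulVec]
  rw [← e, mul_assoc]
  exact (hQ _).trans_lt (by gcongr)

lemma ncard_ball_symmDiff_PhatImg_le {n : ℕ} {P Q : Matrix (Fin n) (Fin n) ℝ}
    (hQP : Q * P = 1) {C : ℝ} (hC : 0 < C) (hQ : ∀ x, ‖Q.mulVec x‖ ≤ C * ‖x‖)
    {Γ B : Set (Fin n → ℝ)} (hΓ : Γ ⊆ intPoints n) (hB : B ⊆ intPoints n) {v w : Fin n → ℝ}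
    (hv : v ∈ intPoints n) (hvw : ‖P.mulVec v - w‖ ≤ 1)
    (hgood : ∀ x ∈ intPoints n, x ∉ B →
      discretizeR (P.mulVec (x + v)) = discretizeR (P.mulVec x) + w)
    {η R : ℝ} (hR : 2 ≤ R)
    (h₁ : ∀ c, ((Metric.ball c (C * 2 * R) ∩ symmDiff (translateSet Γ v) Γ).ncard : ℝ) ≤
      η * (C * 2 * R) ^ n)
    (h₂ : ∀ c, ((Metric.ball c (C * 2 * R) ∩ B).ncard : ℝ) ≤ η * (C * 2 * R) ^ n)
    (c : Fin n → ℝ) :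
    ((Metric.ball c R ∩ symmDiff (translateSet (PhatImg P Γ) w) (PhatImg P Γ)).ncard : ℝ) ≤
      4 * η * (C * 2 * R) ^ n := by
  set S := symmDiff (translateSet Γ v) Γ ∪ translateSet B v with hSdef
  have hS : S ⊆ intPoints n := Set.union_subset (symmDiff_translateSet_subset_intPoints hΓ hv)
    (translateSet_subset_intPoints hB hv)
  set f : (Fin n → ℝ) → Fin n → ℝ := fun z => discretizeR (P.mulVec (z - v)) + w
  set g : (Fin n → ℝ) → Fin n → ℝ := fun z => discretizeR (P.mulVec z)
  have hf : ∀ z, ‖f z - P.mulVec z‖ ≤ 2 := by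
    intro z
    calc ‖f z - P.mulVec z‖ =
        ‖(discretizeR (P.mulVec (z - v)) - P.mulVec (z - v)) - (P.mulVec v - w)‖ := by
          congr 1
          simp only [f, Matrix.mulVec_sub]
          abel
      _ ≤ ‖discretizeR (P.mulVec (z - v)) - P.mulVec (z - v)‖ + ‖P.mulVec v - w‖ :=
          norm_sub_le _ _
      _ ≤ 2 := by linarith [norm_discretizeR_sub_le (P.mulVec (z - v))]
  have hg : ∀ z, ‖g z - P.mulVec z‖ ≤ 2 := fun z => by
    linarith [norm_discretizeR_sub_le (P.mulVec z)]
  have hcard : (Metric.ball c R ∩ symmDiff (translateSet (PhatImg P Γ) w) (PhatImg P Γ)).ncard ≤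
      2 * (Metric.ball (Q.mulVec c) (C * 2 * R) ∩ S).ncard := by
    have hsub := Set.inter_subset_inter_right (Metric.ball c R)
      (symmDiff_PhatImg_subset hΓ hgood)
    rw [Set.inter_union_distrib_left] at hsub
    have hfin := finite_ball_inter hS (Q.mulVec c) (C * 2 * R)
    have h3 := Set.ncard_le_ncard (hsub.trans (Set.union_subset_union
      (ball_inter_image_subset hQP hC hQ S hf c hR) (ball_inter_image_subset hQP hC hQ S hg c hR)))
      ((hfin.image f).union (hfin.image g))
    have h4 := h3.trans (Set.ncard_union_le _ _)
    have h5 := Set.ncard_image_le (f := f) hfin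
    have h6 := Set.ncard_image_le (f := g) hfin
    omega
  have hScard : (Metric.ball (Q.mulVec c) (C * 2 * R) ∩ S).ncard ≤
      (Metric.ball (Q.mulVec c) (C * 2 * R) ∩ symmDiff (translateSet Γ v) Γ).ncard +
      (Metric.ball (Q.mulVec c - v) (C * 2 * R) ∩ B).ncard := by
    rw [hSdef, Set.inter_union_distrib_left, ← ncard_ball_translateSet]
    exact Set.ncard_union_le _ _
  have h7 : ((Metric.ball c R ∩
      symmDiff (translateSet (PhatImg P Γ) w) (PhatImg P Γ)).ncard : ℝ) ≤
      2 * ((Metric.ball (Q.mulVec c) (C * 2 * R) ∩ symmDiff (translateSet Γ v) Γ).ncard +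
      (Metric.ball (Q.mulVec c - v) (C * 2 * R) ∩ B).ncard) := by
    exact_mod_cast hcard.trans (Nat.mul_le_mul_left 2 hScard)
  linarith [h₁ (Q.mulVec c), h₂ (Q.mulVec c - v)]

theorem AlmostPeriodicPattern.PhatImg {n : ℕ} {Γ : Set (Fin n → ℝ)}
    (hΓ : AlmostPeriodicPattern Γ) {P Q : Matrix (Fin n) (Fin n) ℝ} (hPQ : P * Q = 1) :
    AlmostPeriodicPattern (PhatImg P Γ) := by
  have hQP : Q * P = 1 := mul_eq_one_comm.1 hPQ
  refine ⟨PhatImg_subset_intPoints P Γ, ⟨?_, uniformlyDiscrete_of_subset_intPoints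
    (PhatImg_subset_intPoints P Γ)⟩, fun ε hε => ?_⟩
  · refine RelativelyDense.of_mulVec hPQ hΓ.2.1.1 fun x hx => ⟨_, ⟨x, hx, rfl⟩, ?_⟩
    linarith [norm_discretizeR_sub_le (P.mulVec x)]
  obtain ⟨C, hC, hQ⟩ := exists_norm_mulVec_le Q
  have hη : 0 < ε / (8 * (C * 2) ^ n) := by positivity
  obtain ⟨δ, hδ, B, hBi, hB, hgood⟩ := exists_sparse_discretizeR_add P hη
  obtain ⟨N, hNi, hNd, hNw, hN⟩ :=
    relativelyDense_near_intPoints hΓ P (lt_min hδ one_pos) hη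
  have hscale : Tendsto (fun R : ℝ => C * 2 * R) atTop atTop :=
    tendsto_id.const_mul_atTop (by positivity)
  obtain ⟨R₀, hR₀⟩ := eventually_atTop.1 ((hscale.eventually hN).and (hscale.eventually hB))
  refine ⟨max R₀ 2, by positivity,
    {y | ∃ v ∈ N, ∃ w : Fin n → ℤ, ‖P.mulVec v - intVec w‖ < min δ 1 ∧ y = intVec w},
    ?_, ?_, ?_⟩
  · rintro _ ⟨v, -, w, -, rfl⟩
    exact ⟨w, rfl⟩
  · refine RelativelyDense.of_mulVec hPQ hNd fun v hv => ?_
    obtain ⟨w, hw⟩ := hNw v hv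
    refine ⟨intVec w, ⟨v, hv, w, hw, rfl⟩, ?_⟩
    rw [norm_sub_rev]
    exact hw.le.trans (min_le_right _ _)
  · rintro R hR _ ⟨v, hv, w, hw, rfl⟩
    obtain ⟨hR₁, hR₂⟩ := max_le_iff.1 hR
    obtain ⟨h₁, h₂⟩ := hR₀ R hR₁
    refine (DRplus_le_of_ncard_ball_le (ε := ε / 2) (by linarith) (by positivity)
      fun c => ?_).trans_lt (half_lt_self hε)
    refine (ncard_ball_symmDiff_PhatImg_le hQP hC hQ hΓ.1 hBi (hNi hv)
      (hw.le.trans (min_le_right _ _))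
      (hgood v (hNi hv) w (hw.trans_le (min_le_left _ _))) hR₂ (h₁ v hv) h₂ c).trans_eq ?_
    rw [mul_pow (C * 2) R]
    have : (C * 2) ^ n ≠ 0 := by positivity
    generalize (C * 2) ^ n = D at this ⊢
    field_simp
    norm_num

/-- The image of an almost periodic pattern by the discretization of a linear isometry is
still an almost periodic pattern. -/
theorem statement2 {n : ℕ} (Γ : Set (Fin n → ℝ)) (hΓ : AlmostPeriodicPattern Γ)
    (P : Matrix (Fin n) (Fin n) ℝ) (hP : P ∈ Matrix.orthogonalGroup (Fin n) ℝ) :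
    AlmostPeriodicPattern (PhatImg P Γ) := by
  exact hΓ.PhatImg (Matrix.mem_orthogonalGroup_iff _ _ |>.1 hP)

end
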